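/- The code C_O^36 has projection O onto C_4^9: for every codeword v ∈ C_O^36, (i) the vector Proj(v) = (proj(v-column 1), …, proj(v-column 9)) belongs to C_4^9; (ii) all nine columns of v have the same parity (either every column contains an even number of ones, or every column contains an odd number of ones); and (iii) the parity of the first row (v_1, v_5, v_9, …, v_33), i.e. the sum v_1 + v_5 + … + v_33 in GF(2), equals the common parity of the columns. -/

import Mathlib

open Matrix
open scoped Classical

noncomputable section

abbrev F4 := GaloisField 2 2
abbrev F2 := ZMod 2

/-- Hamming weight: number of nonzero coordinates. -/
def wt {n : ℕ} {α : Type*} [Zero α] (v : Fin n → α) : ℕ :=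
  Nat.card {i : Fin n // v i ≠ 0}

def r1 (ω : F4) : Fin 9 → F4 := ![1, 0, 0, 0, 0, ω + 1, 1, 1, 1]
def r2 (ω : F4) : Fin 9 → F4 := ![ω, 0, 0, 0, 0, 1, ω, ω, ω]
def r3 (ω : F4) : Fin 9 → F4 := ![0, 1, 0, 0, 0, 1, ω, ω + 1, 0]
def r4 (ω : F4) : Fin 9 → F4 := ![0, ω, 0, 0, 0, ω, ω + 1, 1, 0]
def r5 (ω : F4) : Fin 9 → F4 := ![0, 0, 1, 0, 0, 0, 1, ω, ω + 1]
def r6 (ω : F4) : Fin 9 → F4 := ![0, 0, ω, 0, 0, 0, ω, ω + 1, 1]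
def r7 (ω : F4) : Fin 9 → F4 := ![0, 0, 0, 1, 0, ω + 1, ω + 1, 0, 1]
def r8 (ω : F4) : Fin 9 → F4 := ![0, 0, 0, ω, 0, 1, 1, 0, ω]
def r9 (ω : F4) : Fin 9 → F4 := ![0, 0, 0, 0, 1, 1, ω, 1, 1]
def r10 (ω : F4) : Fin 9 → F4 := ![0, 0, 0, 0, ω, ω, ω + 1, ω, ω]

/-- The additive code C₄⁹: the GF(2)-linear span of r1, …, r10 in GF(4)⁹. -/
def C49 (ω : F4) : Submodule F2 (Fin 9 → F4) :=
  Submodule.span F2 (Set.range ![r1 ω, r2 ω, r3 ω, r4 ω, r5 ω, r6 ω, r7 ω, r8 ω, r9 ω, r10 ω])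

/-- φ : GF(4) → GF(2)⁴ with φ(0)=0000, φ(1)=0011, φ(ω)=0101, φ(ω̄)=0110. -/
def phi (ω : F4) (x : F4) : Fin 4 → F2 :=
  if x = 0 then ![0, 0, 0, 0]
  else if x = 1 then ![0, 0, 1, 1]
  else if x = ω then ![0, 1, 0, 1]
  else ![0, 1, 1, 0]

/-- Φ applies φ to each coordinate and concatenates. -/
def Phi (ω : F4) (v : Fin 9 → F4) : Fin 36 → F2 := fun j =>
  phi ω (v ⟨j.val / 4, by have := j.isLt; omega⟩) ⟨j.val % 4, by omega⟩

/-- u i (for i = 0, …, 7, corresponding to u_(i+1)) has ones exactly in the eight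
positions 4(i+1)-3, …, 4(i+1)+4 (1-indexed). -/
def u (i : Fin 8) : Fin 36 → F2 := fun j =>
  if 4 * i.val ≤ j.val ∧ j.val < 4 * i.val + 8 then 1 else 0

/-- (1,0,0,0) repeated 9 times. -/
def d1 : Fin 36 → F2 := fun j => if j.val % 4 = 0 then 1 else 0

/-- (1,0,0,0) repeated 8 times followed by (0,1,1,1). -/
def d2 : Fin 36 → F2 := fun j =>
  if j.val < 32 then (if j.val % 4 = 0 then 1 else 0)
  else (if j.val % 4 = 0 then 0 else 1)

def gensO36 (ω : F4) : Fin 19 → Fin 36 → F2 :=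
  ![Phi ω (r1 ω), Phi ω (r2 ω), Phi ω (r3 ω), Phi ω (r4 ω), Phi ω (r5 ω),
    Phi ω (r6 ω), Phi ω (r7 ω), Phi ω (r8 ω), Phi ω (r9 ω), Phi ω (r10 ω),
    u 0, u 1, u 2, u 3, u 4, u 5, u 6, u 7, d1]

def CO36 (ω : F4) : Submodule F2 (Fin 36 → F2) :=
  Submodule.span F2 (Set.range (gensO36 ω))

/-- The i-th column of v ∈ GF(2)³⁶: the block (v_(4i-3), v_(4i-2), v_(4i-1), v_(4i)) (1-indexed). -/
def col (v : Fin 36 → F2) (i : Fin 9) : Fin 4 → F2 := fun k =>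
  v ⟨4 * i.val + k.val, by have := i.isLt; have := k.isLt; omega⟩

/-- proj(a,b,c,d) = b·1 + c·ω + d·ω̄, the inner product with the row labels (0,1,ω,ω̄). -/
def projCol (ω : F4) (c : Fin 4 → F2) : F4 :=
  algebraMap F2 F4 (c 1) * 1 + algebraMap F2 F4 (c 2) * ω + algebraMap F2 F4 (c 3) * (ω + 1)

/-- Parity of the i-th column of v (0 = even, 1 = odd). -/
def colParity (v : Fin 36 → F2) (i : Fin 9) : F2 := ∑ k : Fin 4, col v i k

/-- Parity of the first row (v₁, v₅, …, v₃₃) (1-indexed). -/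
def rowParity (v : Fin 36 → F2) : F2 :=
  ∑ i : Fin 9, v ⟨4 * i.val, by have := i.isLt; omega⟩

/-- The projection property: `v` projects into `C49`, its columns share a common parity,
and that parity is the parity of the first row. -/
def ProjectsOnto (ω : F4) (v : Fin 36 → F2) : Prop :=
  (fun i => projCol ω (col v i)) ∈ C49 ω ∧
    (∀ i j : Fin 9, colParity v i = colParity v j) ∧
    rowParity v = colParity v 0

theorem F4_two_eq_zero : (2 : F4) = 0 := CharTwo.two_eq_zero

theorem F4_cases {ω : F4} (hω : ω ^ 2 = ω + 1) (x : F4) :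
    x = 0 ∨ x = 1 ∨ x = ω ∨ x = ω + 1 := by
  have hx : x ^ 4 = x := by
    have : Fintype F4 := Fintype.ofFinite F4
    have hcard : Fintype.card F4 = 4 := by
      rw [← Nat.card_eq_fintype_card, GaloisField.card 2 2 two_ne_zero]
      norm_num
    simpa [hcard] using FiniteField.pow_card x
  have hprod : x * ((x - 1) * ((x - ω) * (x - (ω + 1)))) = 0 := by
    linear_combination hx + (x ^ 2 - x) * hω +
      (x ^ 2 - x ^ 3 + ω * (1 - x) * (x ^ 2 - x)) * F4_two_eq_zero
  simpa [sub_eq_zero] using hprod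

theorem projCol_phi {ω : F4} (hω : ω ^ 2 = ω + 1) (x : F4) : projCol ω (phi ω x) = x := by
  have h2 := F4_two_eq_zero
  unfold phi
  split_ifs with h0 h1 h
  · simp [projCol, h0]
  · simp only [projCol, h1, Matrix.cons_val, map_zero, map_one]
    linear_combination ω * h2
  · simp only [projCol, h, Matrix.cons_val, map_zero, map_one]
    linear_combination h2
  · have hx : x = ω + 1 := by simpa [h0, h1, h] using F4_cases hω x
    simp only [projCol, hx, Matrix.cons_val, map_zero, map_one]
    ring

theorem sum_phi (ω x : F4) : ∑ k, phi ω x k = 0 := by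
  unfold phi
  split_ifs <;> decide

theorem phi_zero_coord (ω x : F4) : phi ω x 0 = 0 := by
  unfold phi
  split_ifs <;> rfl

theorem col_Phi (ω : F4) (w : Fin 9 → F4) (i : Fin 9) : col (Phi ω w) i = phi ω (w i) := by
  funext k
  have hdiv : (4 * i.val + k.val) / 4 = i.val := by omega
  have hmod : (4 * i.val + k.val) % 4 = k.val := by omega
  simp only [_root_.col, Phi, hdiv, hmod]

theorem rowParity_eq_sum_col (v : Fin 36 → F2) : rowParity v = ∑ i, col v i 0 := rfl

theorem projectsOnto_Phi {ω : F4} (hω : ω ^ 2 = ω + 1) {w : Fin 9 → F4} (hw : w ∈ C49 ω) :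
    ProjectsOnto ω (Phi ω w) := by
  refine ⟨?_, ?_, ?_⟩
  · simpa only [col_Phi, projCol_phi hω] using hw
  · simp only [colParity, col_Phi, sum_phi, implies_true]
  · simp only [rowParity_eq_sum_col, colParity, col_Phi, sum_phi, phi_zero_coord,
      Finset.sum_const_zero]

theorem col_u (i : Fin 8) (j : Fin 9) :
    col (u i) j = fun _ => if j = i.castSucc ∨ j = i.succ then 1 else 0 := by
  funext k
  simp only [_root_.col, u, Fin.ext_iff, Fin.val_castSucc, Fin.val_succ]
  exact if_congr (by omega) rfl rfl

theorem projectsOnto_u (ω : F4) (i : Fin 8) : ProjectsOnto ω (u i) := by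
  have h2 := F4_two_eq_zero
  refine ⟨?_, ?_, ?_⟩
  · convert (C49 ω).zero_mem using 1
    funext j
    rw [col_u]
    simp only [projCol, Pi.zero_apply]
    split_ifs
    · rw [map_one]
      linear_combination (ω + 1) * h2
    · simp
  · simp only [colParity, col_u]
    revert i
    decide
  · simp only [rowParity_eq_sum_col, colParity, col_u]
    revert i
    decide

theorem col_d1 (j : Fin 9) : col d1 j = ![1, 0, 0, 0] := by
  revert j
  unfold _root_.col d1
  decide

theorem projectsOnto_d1 (ω : F4) : ProjectsOnto ω d1 := by
  refine ⟨?_, ?_, ?_⟩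
  · convert (C49 ω).zero_mem using 1
    funext j
    simp [col_d1, projCol]
  · simp only [colParity, col_d1, implies_true]
  · simp only [rowParity_eq_sum_col, colParity, col_d1]
    decide

theorem ProjectsOnto.zero (ω : F4) : ProjectsOnto ω 0 := by
  refine ⟨?_, ?_, ?_⟩
  · convert (C49 ω).zero_mem using 1
    funext j
    simp [projCol, _root_.col]
  · simp [colParity, _root_.col]
  · simp [rowParity, colParity, _root_.col]

theorem ProjectsOnto.add {ω : F4} {v w : Fin 36 → F2} (hv : ProjectsOnto ω v)
    (hw : ProjectsOnto ω w) : ProjectsOnto ω (v + w) := by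
  have hcol (i : Fin 9) : colParity (v + w) i = colParity v i + colParity w i :=
    Finset.sum_add_distrib
  refine ⟨?_, fun i j => ?_, ?_⟩
  · convert (C49 ω).add_mem hv.1 hw.1 using 1
    funext i
    simp only [projCol, _root_.col, Pi.add_apply, map_add]
    ring
  · rw [hcol, hcol, hv.2.1 i j, hw.2.1 i j]
  · rw [hcol, ← hv.2.2, ← hw.2.2]
    exact Finset.sum_add_distrib

theorem ProjectsOnto.smul {ω : F4} (a : F2) {v : Fin 36 → F2} (hv : ProjectsOnto ω v) :
    ProjectsOnto ω (a • v) := by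
  have ha : a = 0 ∨ a = 1 := by
    revert a
    decide
  rcases ha with rfl | rfl
  · simpa using ProjectsOnto.zero ω
  · simpa using hv

theorem projectsOnto_gensO36 {ω : F4} (hω : ω ^ 2 = ω + 1) (n : Fin 19) :
    ProjectsOnto ω (gensO36 ω n) := by
  have hr (m : Fin 10) := projectsOnto_Phi hω (Submodule.subset_span (R := F2)
    (Set.mem_range_self (f := ![r1 ω, r2 ω, r3 ω, r4 ω, r5 ω, r6 ω, r7 ω, r8 ω, r9 ω, r10 ω]) m))
  have hu := projectsOnto_u ω
  fin_cases n
  exacts [hr 0, hr 1, hr 2, hr 3, hr 4, hr 5, hr 6, hr 7, hr 8, hr 9,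
    hu 0, hu 1, hu 2, hu 3, hu 4, hu 5, hu 6, hu 7, projectsOnto_d1 ω]

theorem stmt18 (ω : F4) (hω : ω ^ 2 = ω + 1) :
    ∀ v ∈ CO36 ω,
      (fun i => projCol ω (col v i)) ∈ C49 ω ∧
      (∀ i j : Fin 9, colParity v i = colParity v j) ∧
      rowParity v = colParity v 0 := by
  intro v hv
  change ProjectsOnto ω v
  induction hv using Submodule.span_induction with
  | mem x hx =>
    obtain ⟨n, rfl⟩ := hx
    exact projectsOnto_gensO36 hω n
  | zero => exact ProjectsOnto.zero ω
  | add x y _ _ hx hy => exact hx.add hy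
  | smul a x _ hx => exact hx.smul a
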